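/- Let G be a graph. Then G is (2P_3,C_4,C_6)-free, contains an induced C_7, and contains no simplicial vertices if and only if G is (4K_1,C_4,C_6)-free and contains an induced C_7. -/

import Mathlib

open SimpleGraph

namespace Paper2P3

variable {V : Type*}

/-- `G` contains an induced subgraph isomorphic to `H`. -/
def ContainsInduced {V W : Type*} (G : SimpleGraph V) (H : SimpleGraph W) : Prop :=
  ∃ s : Set V, Nonempty (H ≃g G.induce s)

/-- `G` is `H`-free: no induced subgraph of `G` is isomorphic to `H`. -/
def HFree {V W : Type*} (G : SimpleGraph V) (H : SimpleGraph W) : Prop :=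
  ¬ ContainsInduced G H

/-- `S` is complete to `T` in `G`. -/
def Complete (G : SimpleGraph V) (S T : Set V) : Prop :=
  ∀ a ∈ S, ∀ b ∈ T, G.Adj a b

/-- `S` is anticomplete to `T` in `G`. -/
def Anticomplete (G : SimpleGraph V) (S T : Set V) : Prop :=
  ∀ a ∈ S, ∀ b ∈ T, ¬ G.Adj a b

/-- The closed neighborhood `N_G[v]`. -/
def closedNbhd (G : SimpleGraph V) (v : V) : Set V := insert v (G.neighborSet v)

/-- A simplicial vertex: its neighborhood is a clique. -/
def IsSimplicial (G : SimpleGraph V) (v : V) : Prop := G.IsClique (G.neighborSet v)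

/-- A universal vertex: adjacent to all other vertices. -/
def IsUniversalVertex (G : SimpleGraph V) (v : V) : Prop := ∀ w, w ≠ v → G.Adj v w

/-- `G` admits a clique-cutset: a clique `C ⊊ V(G)` such that `G - C` is disconnected. -/
def HasCliqueCutset (G : SimpleGraph V) : Prop :=
  ∃ C : Set V, G.IsClique C ∧ C ≠ Set.univ ∧ ¬ (G.induce Cᶜ).Connected

/-- The disjoint union of two copies of `P_3`, on vertices `0,1,2` and `3,4,5`. -/
def twoP3 : SimpleGraph (Fin 6) :=
  SimpleGraph.fromRel fun a b => (a, b) ∈ ([(0,1),(1,2),(3,4),(4,5)] : List (Fin 6 × Fin 6))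

/-- The edgeless graph on four vertices. -/
def fourK1 : SimpleGraph (Fin 4) := ⊥

/-- `Gs` is a thickening of `G`. -/
def IsThickening {α β : Type*} (Gs : SimpleGraph β) (G : SimpleGraph α) : Prop :=
  ∃ X : α → Set β,
    (∀ v, (X v).Nonempty) ∧
    (∀ u v : α, u ≠ v → Disjoint (X u) (X v)) ∧
    (⋃ v, X v) = Set.univ ∧
    (∀ v, Gs.IsClique (X v)) ∧
    (∀ u v : α, u ≠ v →
      (G.Adj u v → Complete Gs (X u) (X v)) ∧ (¬ G.Adj u v → Anticomplete Gs (X u) (X v)))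

/-- The closed neighborhoods of the vertices of `S` form a chain under inclusion;
equivalently (for finite graphs), `S` can be ordered as `a_1, …, a_r` with
`N_G[a_r] ⊆ ⋯ ⊆ N_G[a_1]`. -/
def ChainClosedNbhd (G : SimpleGraph V) (S : Set V) : Prop :=
  ∀ a ∈ S, ∀ b ∈ S, closedNbhd G a ⊆ closedNbhd G b ∨ closedNbhd G b ⊆ closedNbhd G a

/-- `A` can be partitioned into cliques, pairwise anticomplete to each other. -/
def CliquesPartition (G : SimpleGraph V) (A : Set V) : Prop :=
  ∃ (ℓ : ℕ) (P : Fin ℓ → Set V),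
    (∀ i, G.IsClique (P i)) ∧
    (∀ i j, i ≠ j → Disjoint (P i) (P j)) ∧
    (∀ i j, i ≠ j → Anticomplete G (P i) (P j)) ∧
    (⋃ i, P i) = A

/-- `A` can be partitioned into nonempty cliques, pairwise anticomplete to each other. -/
def NonemptyCliquesPartition (G : SimpleGraph V) (A : Set V) : Prop :=
  ∃ (ℓ : ℕ) (P : Fin ℓ → Set V),
    (∀ i, (P i).Nonempty) ∧
    (∀ i, G.IsClique (P i)) ∧
    (∀ i j, i ≠ j → Disjoint (P i) (P j)) ∧
    (∀ i j, i ≠ j → Anticomplete G (P i) (P j)) ∧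
    (⋃ i, P i) = A

/-- `A` can be partitioned into nonempty cliques, pairwise anticomplete to each other,
each of which can be ordered so that the closed neighborhoods form a decreasing chain. -/
def OrderedCliquesPartition (G : SimpleGraph V) (A : Set V) : Prop :=
  ∃ (ℓ : ℕ) (P : Fin ℓ → Set V),
    (∀ i, (P i).Nonempty) ∧
    (∀ i, G.IsClique (P i)) ∧
    (∀ i j, i ≠ j → Disjoint (P i) (P j)) ∧
    (∀ i j, i ≠ j → Anticomplete G (P i) (P j)) ∧
    (⋃ i, P i) = A ∧
    (∀ i, ChainClosedNbhd G (P i))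

/-- `(X_0,…,X_6; Y_0,…,Y_6; Z_0,…,Z_6; W)` is a special partition of the induced
subgraph of `G` on `S` (indices in `ℤ_7`). -/
def IsSpecialPartitionOn (G : SimpleGraph V) (S : Set V)
    (X Y Z : ZMod 7 → Set V) (W : Set V) : Prop :=
  -- the sets are pairwise disjoint and their union is `S`
  (∀ i j, i ≠ j → Disjoint (X i) (X j)) ∧
  (∀ i j, i ≠ j → Disjoint (Y i) (Y j)) ∧
  (∀ i j, i ≠ j → Disjoint (Z i) (Z j)) ∧
  (∀ i j, Disjoint (X i) (Y j)) ∧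
  (∀ i j, Disjoint (X i) (Z j)) ∧
  (∀ i j, Disjoint (Y i) (Z j)) ∧
  (∀ i, Disjoint (X i) W) ∧ (∀ i, Disjoint (Y i) W) ∧ (∀ i, Disjoint (Z i) W) ∧
  ((⋃ i, X i) ∪ (⋃ i, Y i) ∪ (⋃ i, Z i) ∪ W = S) ∧
  -- all the sets are cliques
  (∀ i, G.IsClique (X i)) ∧ (∀ i, G.IsClique (Y i)) ∧ (∀ i, G.IsClique (Z i)) ∧
  G.IsClique W ∧
  -- (a)
  (∀ i, (X i).Nonempty) ∧
  -- (b)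
  (∀ i, Complete G (X i) (X (i - 1)) ∧ Complete G (X i) (X (i + 1)) ∧
    Anticomplete G (X i) (X (i + 2)) ∧ Anticomplete G (X i) (X (i + 3)) ∧
    Anticomplete G (X i) (X (i + 4)) ∧ Anticomplete G (X i) (X (i + 5))) ∧
  -- (c)
  (∀ i, Complete G (X i) (Y i) ∧ Complete G (X i) (Y (i + 3)) ∧
    Complete G (X i) (Y (i + 6)) ∧ Complete G (X i) (Z i) ∧
    Complete G (X i) (Z (i + 3)) ∧ Complete G (X i) (Z (i + 4)) ∧
    Complete G (X i) (Z (i + 5)) ∧ Complete G (X i) (Z (i + 6)) ∧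
    Complete G (X i) W ∧
    Anticomplete G (X i) (Y (i + 1)) ∧ Anticomplete G (X i) (Y (i + 2)) ∧
    Anticomplete G (X i) (Y (i + 4)) ∧ Anticomplete G (X i) (Y (i + 5)) ∧
    Anticomplete G (X i) (Z (i + 1)) ∧ Anticomplete G (X i) (Z (i + 2))) ∧
  -- (d)
  (∀ i, (Y i).Nonempty →
    (Y (i + 1) = ∅ ∧ Y (i + 2) = ∅ ∧ Y (i + 5) = ∅ ∧ Y (i + 6) = ∅ ∧
      Z (i + 5) = ∅ ∧ Z (i + 6) = ∅) ∧ (Y (i + 3) = ∅ ∨ Y (i + 4) = ∅)) ∧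
  -- (e)
  (∀ i, (Z i).Nonempty → Z (i + 2) = ∅ ∧ Z (i + 5) = ∅) ∧
  -- (f)
  (∀ i, Complete G (Y i) (Y (i + 3)) ∧ Complete G (Y i) (Y (i + 4)) ∧
    Complete G (Y i) (Z i) ∧ Complete G (Y i) (Z (i + 1)) ∧
    Complete G (Y i) (Z (i + 3)) ∧ Complete G (Y i) (Z (i + 4)) ∧
    Complete G (Y i) W ∧ Anticomplete G (Y i) (Z (i + 2))) ∧
  -- (g)
  (∀ i, Complete G (Z i) (Z (i + 1)) ∧ Complete G (Z i) (Z (i + 3)) ∧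
    Complete G (Z i) (Z (i + 4)) ∧ Complete G (Z i) (Z (i + 6)) ∧ Complete G (Z i) W)

/-- `G` admits a special partition. -/
def AdmitsSpecialPartition (G : SimpleGraph V) : Prop :=
  ∃ (X Y Z : ZMod 7 → Set V) (W : Set V), IsSpecialPartitionOn G Set.univ X Y Z W

/-- `G` is a 7-saucer. -/
def IsSevenSaucer (G : SimpleGraph V) : Prop :=
  ∃ (X Y Z : ZMod 7 → Set V) (W A : Set V),
    IsSpecialPartitionOn G Aᶜ X Y Z W ∧
    (∀ i, Anticomplete G A (X i)) ∧
    (∀ i, Anticomplete G A (Y i) ∨ Z (i + 2) = ∅) ∧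
    (A = ∅ ∨ OrderedCliquesPartition G A)
/-- The graph `M_0`: vertices `0,…,6` are `x_0,…,x_6` (a 7-cycle), `7 = y_0`,
`8 = y_3`, `9 = z_0`, `10 = z_3`, `11 = z_4`. -/
def M0 : SimpleGraph (Fin 12) :=
  SimpleGraph.fromRel fun a b => (a, b) ∈
    ([(0,1),(1,2),(2,3),(3,4),(4,5),(5,6),(6,0),
      (7,0),(7,1),(7,4),
      (8,3),(8,4),(8,0),
      (9,0),(9,1),(9,2),(9,3),(9,4),
      (10,3),(10,4),(10,5),(10,6),(10,0),
      (11,4),(11,5),(11,6),(11,0),(11,1),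
      (7,8),(7,9),(7,10),(7,11),(8,9),(8,10),(8,11),(9,10),(9,11),(10,11)] :
      List (Fin 12 × Fin 12))

/-- The graph `M_1`: vertices `0,…,6` are `x_0,…,x_6` (a 7-cycle), `7 = y_0`, `8 = z_2`. -/
def M1 : SimpleGraph (Fin 9) :=
  SimpleGraph.fromRel fun a b => (a, b) ∈
    ([(0,1),(1,2),(2,3),(3,4),(4,5),(5,6),(6,0),
      (7,0),(7,1),(7,4),
      (8,2),(8,3),(8,4),(8,5),(8,6)] : List (Fin 9 × Fin 9))

/-- The graph `M_2`: `M_1` plus the vertex `9 = z_1`. -/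
def M2 : SimpleGraph (Fin 10) :=
  SimpleGraph.fromRel fun a b => (a, b) ∈
    ([(0,1),(1,2),(2,3),(3,4),(4,5),(5,6),(6,0),
      (7,0),(7,1),(7,4),
      (8,2),(8,3),(8,4),(8,5),(8,6),
      (9,1),(9,2),(9,3),(9,4),(9,5),(9,7),(9,8)] : List (Fin 10 × Fin 10))

/-- The graph `M_3`: `M_1` plus the vertex `9 = z_3`. -/
def M3 : SimpleGraph (Fin 10) :=
  SimpleGraph.fromRel fun a b => (a, b) ∈
    ([(0,1),(1,2),(2,3),(3,4),(4,5),(5,6),(6,0),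
      (7,0),(7,1),(7,4),
      (8,2),(8,3),(8,4),(8,5),(8,6),
      (9,3),(9,4),(9,5),(9,6),(9,0),(9,7),(9,8)] : List (Fin 10 × Fin 10))

/-- The set `{y_0, y_3, z_0, z_3, z_4}` of vertices of `M_0`. -/
def M0Extra : Set (Fin 12) := {7, 8, 9, 10, 11}

/-- `H` is a thickening of a graph in the family `ℳ`, which consists of
`M_1`, `M_2`, `M_3`, and all graphs `M_0 - S` for `S ⊆ {y_0,y_3,z_0,z_3,z_4}`. -/
def IsThickeningOfM {β : Type*} (H : SimpleGraph β) : Prop :=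
  IsThickening H M1 ∨ IsThickening H M2 ∨ IsThickening H M3 ∨
  ∃ S : Set (Fin 12), S ⊆ M0Extra ∧ IsThickening H (M0.induce Sᶜ)
/-- The graph `T_0`: vertices `0 = a_0`, `1 = a_1`, `2 = b_0`, `3 = b_1`, `4 = b_2`,
`5 = b_3`, `6 = c_1`, `7 = c_2`, `8 = c_3`. -/
def T0 : SimpleGraph (Fin 9) :=
  SimpleGraph.fromRel fun a b => (a, b) ∈
    ([(0,1),(0,2),(0,4),(0,5),(1,3),(1,4),(1,5),
      (2,6),(3,6),(4,7),(5,8),(6,7),(6,8),(7,8)] : List (Fin 9 × Fin 9))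

/-- The graph `T_1`: `T_0` plus the vertex `9 = f_3`, adjacent to
`a_0,a_1,b_0,b_1,b_2,c_1,c_2` and nonadjacent to `b_3,c_3`. -/
def T1 : SimpleGraph (Fin 10) :=
  SimpleGraph.fromRel fun a b => (a, b) ∈
    ([(0,1),(0,2),(0,4),(0,5),(1,3),(1,4),(1,5),
      (2,6),(3,6),(4,7),(5,8),(6,7),(6,8),(7,8),
      (9,0),(9,1),(9,2),(9,3),(9,4),(9,6),(9,7)] : List (Fin 10 × Fin 10))
/-- `(A_0,A_1;B_0,B_1,B_2,B_3;C_1,C_2,C_3;F_2,F_3;W;Y;Z)` is a tent partition of `G`. -/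
def IsTentPartition (G : SimpleGraph V)
    (A0 A1 B0 B1 B2 B3 C1 C2 C3 F2 F3 W Y Z : Set V) : Prop :=
  let P : Fin 14 → Set V := ![A0, A1, B0, B1, B2, B3, C1, C2, C3, F2, F3, W, Y, Z]
  -- the fourteen sets form a partition of the vertex set
  (∀ i j : Fin 14, i ≠ j → Disjoint (P i) (P j)) ∧
  (⋃ i, P i) = Set.univ ∧
  -- A_0,A_1,B_0,B_1,B_2,B_3,C_1,C_2,C_3 are nonempty cliques
  (A0.Nonempty ∧ A1.Nonempty ∧ B0.Nonempty ∧ B1.Nonempty ∧ B2.Nonempty ∧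
    B3.Nonempty ∧ C1.Nonempty ∧ C2.Nonempty ∧ C3.Nonempty) ∧
  (G.IsClique A0 ∧ G.IsClique A1 ∧ G.IsClique B0 ∧ G.IsClique B1 ∧ G.IsClique B2 ∧
    G.IsClique B3 ∧ G.IsClique C1 ∧ G.IsClique C2 ∧ G.IsClique C3) ∧
  -- F_2, F_3, Y are cliques, and at most one of them is nonempty
  (G.IsClique F2 ∧ G.IsClique F3 ∧ G.IsClique Y) ∧
  ((F2 = ∅ ∧ F3 = ∅) ∨ (F2 = ∅ ∧ Y = ∅) ∨ (F3 = ∅ ∧ Y = ∅)) ∧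
  -- W is a (possibly empty) clique
  G.IsClique W ∧
  Complete G A0 A1 ∧
  (Complete G A0 B0 ∧ Complete G A0 B2 ∧ Complete G A0 B3 ∧
    Anticomplete G A0 B1 ∧ Anticomplete G A0 C1 ∧ Anticomplete G A0 C2 ∧
    Anticomplete G A0 C3) ∧
  (Complete G A1 B1 ∧ Complete G A1 B2 ∧ Complete G A1 B3 ∧
    Anticomplete G A1 B0 ∧ Anticomplete G A1 C1 ∧ Anticomplete G A1 C2 ∧
    Anticomplete G A1 C3) ∧
  (Anticomplete G B0 B1 ∧ Anticomplete G B0 B2 ∧ Anticomplete G B0 B3 ∧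
    Anticomplete G B1 B2 ∧ Anticomplete G B1 B3 ∧ Anticomplete G B2 B3) ∧
  (Complete G C1 C2 ∧ Complete G C1 C3 ∧ Complete G C2 C3) ∧
  (Complete G C1 B0 ∧ Complete G C1 B1 ∧ Anticomplete G C1 B2 ∧ Anticomplete G C1 B3) ∧
  (Complete G C2 B2 ∧ Anticomplete G C2 B0 ∧ Anticomplete G C2 B1 ∧
    Anticomplete G C2 B3) ∧
  (Complete G C3 B3 ∧ Anticomplete G C3 B0 ∧ Anticomplete G C3 B1 ∧
    Anticomplete G C3 B2) ∧
  (Complete G F2 A0 ∧ Complete G F2 A1 ∧ Complete G F2 B0 ∧ Complete G F2 B1 ∧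
    Complete G F2 B3 ∧ Complete G F2 C1 ∧ Complete G F2 C3 ∧
    Anticomplete G F2 B2 ∧ Anticomplete G F2 C2) ∧
  (Complete G F3 A0 ∧ Complete G F3 A1 ∧ Complete G F3 B0 ∧ Complete G F3 B1 ∧
    Complete G F3 B2 ∧ Complete G F3 C1 ∧ Complete G F3 C2 ∧
    Anticomplete G F3 B3 ∧ Anticomplete G F3 C3) ∧
  (Complete G W A0 ∧ Complete G W A1 ∧ Complete G W B0 ∧ Complete G W B1 ∧
    Complete G W B2 ∧ Complete G W B3 ∧ Complete G W C1 ∧ Complete G W C2 ∧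
    Complete G W C3 ∧ Complete G W F2 ∧ Complete G W F3) ∧
  (Complete G Y C2 ∧ Complete G Y C3 ∧
    Anticomplete G Y A0 ∧ Anticomplete G Y A1 ∧ Anticomplete G Y B0 ∧
    Anticomplete G Y B1 ∧ Anticomplete G Y B2 ∧ Anticomplete G Y B3 ∧
    Anticomplete G Y C1) ∧
  (Anticomplete G Z A0 ∧ Anticomplete G Z A1 ∧ Anticomplete G Z B0 ∧
    Anticomplete G Z B1 ∧ Anticomplete G Z B2 ∧ Anticomplete G Z B3 ∧
    Anticomplete G Z C1 ∧ Anticomplete G Z C2 ∧ Anticomplete G Z C3 ∧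
    Anticomplete G Z Y) ∧
  -- Y can be ordered so that the closed neighborhoods form a chain
  ChainClosedNbhd G Y ∧
  -- Z is empty or can be partitioned into nonempty cliques, pairwise anticomplete,
  -- each ordered so that the closed neighborhoods form a chain
  (Z = ∅ ∨ OrderedCliquesPartition G Z)

/-- `G` is a tent. -/
def IsTent (G : SimpleGraph V) : Prop :=
  ∃ A0 A1 B0 B1 B2 B3 C1 C2 C3 F2 F3 W Y Z : Set V,
    IsTentPartition G A0 A1 B0 B1 B2 B3 C1 C2 C3 F2 F3 W Y Z

section Induced

variable {W : Type*} {G : SimpleGraph V} {H : SimpleGraph W}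

theorem containsInduced_iff : ContainsInduced G H ↔ Nonempty (H ↪g G) := by
  constructor
  · rintro ⟨s, ⟨e⟩⟩
    exact ⟨(Embedding.induce s).comp e.toEmbedding⟩
  · rintro ⟨f⟩
    exact ⟨Set.range f, ⟨⟨Equiv.ofInjective f f.injective, f.map_rel_iff⟩⟩⟩

/-- An injective map that preserves and reflects adjacency contradicts `H`-freeness. -/
theorem HFree.elim (h : HFree G H) (f : W → V) (hf : Function.Injective f)
    (hadj : ∀ i j, G.Adj (f i) (f j) ↔ H.Adj i j) : False :=
  h (containsInduced_iff.2 ⟨⟨⟨f, hf⟩, hadj _ _⟩⟩)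

theorem HFree.fourK1_elim (h : HFree G fourK1) {a b c d : V}
    (hab : a ≠ b) (hac : a ≠ c) (had : a ≠ d) (hbc : b ≠ c) (hbd : b ≠ d) (hcd : c ≠ d)
    (nab : ¬ G.Adj a b) (nac : ¬ G.Adj a c) (nad : ¬ G.Adj a d)
    (nbc : ¬ G.Adj b c) (nbd : ¬ G.Adj b d) (ncd : ¬ G.Adj c d) : False := by
  refine h.elim ![a, b, c, d] ?_ ?_
  · intro i j hij
    fin_cases i <;> fin_cases j <;> simp_all
  · intro i j
    fin_cases i <;> fin_cases j <;> simp_all [fourK1, G.adj_comm]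

theorem HFree.cycle4_elim (h : HFree G (cycleGraph 4)) {a b c d : V}
    (ab : G.Adj a b) (bc : G.Adj b c) (cd : G.Adj c d) (da : G.Adj d a)
    (hac : a ≠ c) (hbd : b ≠ d) (nac : ¬ G.Adj a c) (nbd : ¬ G.Adj b d) : False := by
  have h1 := ab.ne; have h2 := bc.ne; have h3 := cd.ne; have h4 := da.ne
  have ncA : ¬ G.Adj c a := fun e => nac e.symm
  have ndB : ¬ G.Adj d b := fun e => nbd e.symm
  refine h.elim ![a, b, c, d] ?_ ?_
  · intro i j hij
    fin_cases i <;> fin_cases j <;> simp_all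
  · intro i j
    rw [cycleGraph_adj]
    fin_cases i <;> fin_cases j <;>
      simp [ab, bc, cd, da, ab.symm, bc.symm, cd.symm, da.symm, nac, nbd, ncA, ndB] <;> decide

theorem HFree.cycle6_elim (h : HFree G (cycleGraph 6)) {a b c d e f : V}
    (ab : G.Adj a b) (bc : G.Adj b c) (cd : G.Adj c d) (de : G.Adj d e) (ef : G.Adj e f)
    (fa : G.Adj f a)
    (ac : ¬ G.Adj a c) (ad : ¬ G.Adj a d) (ae : ¬ G.Adj a e)
    (bd : ¬ G.Adj b d) (be : ¬ G.Adj b e) (bf : ¬ G.Adj b f)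
    (ce : ¬ G.Adj c e) (cf : ¬ G.Adj c f) (df : ¬ G.Adj d f) : False := by
  have adj : ∀ i j, G.Adj (![a, b, c, d, e, f] i) (![a, b, c, d, e, f] j) ↔
      (cycleGraph 6).Adj i j := by
    intro i j
    rw [cycleGraph_adj]
    fin_cases i <;> fin_cases j <;>
      simp [ab, bc, cd, de, ef, fa, ab.symm, bc.symm, cd.symm, de.symm, ef.symm, fa.symm,
        ac, ad, ae, bd, be, bf, ce, cf, df, mt Adj.symm ac, mt Adj.symm ad, mt Adj.symm ae,
        mt Adj.symm bd, mt Adj.symm be, mt Adj.symm bf, mt Adj.symm ce, mt Adj.symm cf,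
        mt Adj.symm df] <;> decide
  refine h.elim _ (fun i j hij => ?_) adj
  have key : ∀ i j : Fin 6, (∀ k, (cycleGraph 6).Adj i k ↔ (cycleGraph 6).Adj j k) → i = j := by
    simp only [cycleGraph_adj]
    decide
  exact key i j fun k => by rw [← adj, ← adj, hij]

instance : DecidableRel twoP3.Adj := fun a b =>
  decidable_of_iff (a ≠ b ∧ ((a, b) ∈ ([(0,1),(1,2),(3,4),(4,5)] : List (Fin 6 × Fin 6)) ∨
    (b, a) ∈ ([(0,1),(1,2),(3,4),(4,5)] : List (Fin 6 × Fin 6)))) (by rw [twoP3, fromRel_adj])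

theorem HFree.twoP3_elim (h : HFree G twoP3) {a b c d e f : V}
    (ab : G.Adj a b) (bc : G.Adj b c) (de : G.Adj d e) (ef : G.Adj e f)
    (hac : a ≠ c) (hdf : d ≠ f) (ac : ¬ G.Adj a c) (df : ¬ G.Adj d f)
    (ad : ¬ G.Adj a d) (ae : ¬ G.Adj a e) (af : ¬ G.Adj a f)
    (bd : ¬ G.Adj b d) (be : ¬ G.Adj b e) (bf : ¬ G.Adj b f)
    (cd : ¬ G.Adj c d) (ce : ¬ G.Adj c e) (cf : ¬ G.Adj c f) : False := by
  have adj : ∀ i j, G.Adj (![a, b, c, d, e, f] i) (![a, b, c, d, e, f] j) ↔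
      twoP3.Adj i j := by
    intro i j
    rw [twoP3, fromRel_adj]
    fin_cases i <;> fin_cases j <;>
      simp [ab, bc, de, ef, ab.symm, bc.symm, de.symm, ef.symm,
        ac, ad, ae, bd, be, bf, ce, cf, df, af, cd, mt Adj.symm ac, mt Adj.symm ad,
        mt Adj.symm ae, mt Adj.symm bd, mt Adj.symm be, mt Adj.symm bf, mt Adj.symm ce,
        mt Adj.symm cf, mt Adj.symm df, mt Adj.symm af, mt Adj.symm cd]
  refine h.elim _ (fun i j hij => ?_) adj
  have key : ∀ i j : Fin 6, (∀ k, twoP3.Adj i k ↔ twoP3.Adj j k) →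
      i = j ∨ (i, j) ∈ ([(0, 2), (2, 0), (3, 5), (5, 3)] : List (Fin 6 × Fin 6)) := by
    decide
  rcases key i j fun k => by rw [← adj, ← adj, hij] with hk | hk
  · exact hk
  · simp only [List.mem_cons, Prod.mk.injEq, List.not_mem_nil, or_false] at hk
    rcases hk with ⟨rfl, rfl⟩ | ⟨rfl, rfl⟩ | ⟨rfl, rfl⟩ | ⟨rfl, rfl⟩
    · exact (hac hij).elim
    · exact (hac hij.symm).elim
    · exact (hdf hij).elim
    · exact (hdf hij.symm).elim

/-- The ends of the two paths of `2P_3` form a stable set of size four. -/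
theorem HFree.twoP3_of_fourK1 (h : HFree G fourK1) : HFree G twoP3 := by
  intro hc
  obtain ⟨f⟩ := containsInduced_iff.1 hc
  have hadj : ∀ i j, G.Adj (f i) (f j) ↔ twoP3.Adj i j := fun i j => f.map_adj_iff
  apply h.fourK1_elim (a := f 0) (b := f 2) (c := f 3) (d := f 5) <;>
    first
    | exact f.injective.ne (by decide)
    | (rw [hadj]; decide)

end Induced

section Shapes

/-- Adjacency in the cycle of length seven. -/
def cyc (i j : Fin 7) : Bool := j = i + 1 || i = j + 1

/-- The possible traces of closed neighborhoods on an induced `C_7`: empty, three consecutive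
vertices, two consecutive vertices with the vertex opposite to them, five consecutive vertices,
everything. -/
def shape (k : Fin 5) (i j : Fin 7) : Bool :=
  (![[], [6, 0, 1], [0, 1, 4], [0, 1, 2, 3, 4], [0, 1, 2, 3, 4, 5, 6]] k : List (Fin 7)).contains
    (j - i)

theorem exists_eq_shape : ∀ t : Fin 7 → Bool,
    (∀ i, t i → t (i + 2) → t (i + 1)) →
    (∀ i, t i → t (i + 4) → t (i + 1) ∨ t (i + 2) ∨ t (i + 3)) →
    (∀ i, t i → t (i + 6) ∨ t (i + 2) ∨ t (i + 3) ∨ t (i + 4)) →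
    ∃ k i, ∀ j, t j = shape k i j := by
  decide +kernel

theorem shape_eq_of_eq_off : ∀ (k : Fin 5) (i : Fin 7) (k' : Fin 5) (i' m : Fin 7),
    (∀ j, j ≠ m → shape k i j = shape k' i' j) → shape k i m = shape k' i' m := by
  decide +kernel

theorem not_consecutive_shape : ∀ (k : Fin 5) (i m : Fin 7), k ≠ 1 →
    ∃ j, shape k i j ≠ shape 1 m j := by
  decide +kernel

/-- Two large shapes share a vertex or are linked by a path of three vertices, each end being
attached to one of them. -/
theorem shape_meet_or_linked : ∀ (k : Fin 5) (i : Fin 7) (k' : Fin 5) (i' : Fin 7),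
    1 < k → 1 < k' →
    (∃ j, shape k i j ∧ shape k' i' j) ∨
    (∃ j, shape k i j ∧ ¬ shape k i (j + 1) ∧ ¬ shape k i (j + 2) ∧
      ¬ shape k' i' j ∧ ¬ shape k' i' (j + 1) ∧ shape k' i' (j + 2)) ∨
    (∃ j, shape k' i' j ∧ ¬ shape k' i' (j + 1) ∧ ¬ shape k' i' (j + 2) ∧
      ¬ shape k i j ∧ ¬ shape k i (j + 1) ∧ shape k i (j + 2)) := by
  decide +kernel

/-- Two shapes share two nonadjacent vertices. -/
def SharePair (k : Fin 5) (i : Fin 7) (k' : Fin 5) (i' : Fin 7) : Prop :=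
  ∃ c d, c ≠ d ∧ cyc c d = false ∧ shape k i c ∧ shape k i d ∧ shape k' i' c ∧ shape k' i' d

instance (k : Fin 5) (i : Fin 7) (k' : Fin 5) (i' : Fin 7) : Decidable (SharePair k i k' i') := by
  unfold SharePair; infer_instance

theorem sharePair_or_private_edge : ∀ (k : Fin 5) (i : Fin 7) (k' : Fin 5) (i' : Fin 7),
    1 < k → 1 < k' →
    SharePair k i k' i' ∨
    (∃ c d, cyc c d ∧ shape k i c ∧ ¬ shape k' i' c ∧ ¬ shape k i d ∧ shape k' i' d) := by
  decide +kernel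

/-- The configurations of two vertices of type `Y` that produce an induced `2P_3`. -/
def PatternTwoP3 (i i' j : Fin 7) : Prop :=
  shape 2 i j ∧ ¬ shape 2 i (j + 6) ∧ ¬ shape 2 i (j + 2) ∧ ¬ shape 2 i (j + 3) ∧
    shape 2 i' (j + 2) ∧ ¬ shape 2 i' (j + 3) ∧ ¬ shape 2 i' j ∧ ¬ shape 2 i' (j + 6)

instance (i i' j : Fin 7) : Decidable (PatternTwoP3 i i' j) := by
  unfold PatternTwoP3; infer_instance

/-- The configurations of two vertices of type `Y` that produce an induced `C_6`. -/
def PatternC6 (i i' j : Fin 7) : Prop :=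
  shape 2 i j ∧ shape 2 i (j + 3) ∧ ¬ shape 2 i (j + 6) ∧ ¬ shape 2 i (j + 2) ∧
    shape 2 i' (j + 6) ∧ shape 2 i' (j + 2) ∧ ¬ shape 2 i' j ∧ ¬ shape 2 i' (j + 3)

instance (i i' j : Fin 7) : Decidable (PatternC6 i i' j) := by
  unfold PatternC6; infer_instance

theorem shape_two_cases : ∀ i i' : Fin 7, SharePair 2 i 2 i' ∨
    (∃ j, PatternTwoP3 i i' j ∨ PatternTwoP3 i' i j) ∨
    (∃ j, PatternC6 i i' j ∨ PatternC6 i' i j) := by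
  decide +kernel

/-- The conditions satisfied by the shapes of two distinct nonadjacent vertices. -/
def Compatible (p q : Fin 5 × Fin 7) : Prop :=
  (p.1 = 1 → ¬ shape q.1 q.2 p.2) ∧ (q.1 = 1 → ¬ shape p.1 p.2 q.2) ∧
    ¬ (p.1 = 2 ∧ q.1 = 2) ∧ ¬ SharePair p.1 p.2 q.1 q.2

instance (p q : Fin 5 × Fin 7) : Decidable (Compatible p q) := by
  unfold Compatible; infer_instance

theorem not_four_compatible : ∀ p q : Fin 5 × Fin 7, p.1 ≠ 0 → q.1 ≠ 0 → Compatible p q →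
    ∀ r : Fin 5 × Fin 7, r.1 ≠ 0 → Compatible p r → Compatible q r →
    ∀ s : Fin 5 × Fin 7, s.1 ≠ 0 → Compatible p s → Compatible q s → ¬ Compatible r s := by
  decide +kernel

/-- Two nonadjacent vertices in a shape. -/
theorem exists_nonadj_of_ne_zero : ∀ (k : Fin 5) (i : Fin 7), k ≠ 0 →
    ∃ c d, c ≠ d ∧ cyc c d = false ∧ shape k i c ∧ shape k i d := by
  decide +kernel

end Shapes

section Trace

variable {G : SimpleGraph V}

/-- The closed neighborhood of `v` meets the induced cycle `x` exactly in the shape `k` based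
at `i`. -/
def HasShape (x : cycleGraph 7 ↪g G) (v : V) (k : Fin 5) (i : Fin 7) : Prop :=
  ∀ j, (v = x j ∨ G.Adj v (x j)) ↔ shape k i j = true

variable {x : cycleGraph 7 ↪g G} {u v a b : V} {k k' : Fin 5} {i i' : Fin 7}

theorem adj_cycle_iff (x : cycleGraph 7 ↪g G) (i j : Fin 7) :
    G.Adj (x i) (x j) ↔ cyc i j = true := by
  rw [x.map_adj_iff, cycleGraph_adj]
  revert i j
  decide

theorem hasShape_vertex (x : cycleGraph 7 ↪g G) (m : Fin 7) : HasShape x (x m) 1 m := by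
  intro j
  rw [x.injective.eq_iff, adj_cycle_iff]
  revert m j
  decide

theorem HasShape.ne_vertex (h : HasShape x v k i) (hk : k ≠ 1) (j : Fin 7) : v ≠ x j := by
  rintro rfl
  obtain ⟨m, hm⟩ := not_consecutive_shape k i j hk
  exact hm (Bool.eq_iff_iff.2 ((h m).symm.trans (hasShape_vertex x j m)))

theorem HasShape.adj_iff (h : HasShape x v k i) (hk : k ≠ 1) (j : Fin 7) :
    G.Adj v (x j) ↔ shape k i j = true := by
  rw [← h j, or_iff_right (h.ne_vertex hk j)]

theorem not_shape_zero : ∀ i j : Fin 7, ¬ shape 0 i j = true := by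
  decide

theorem not_adj_of_hasShape_zero (h : HasShape x v 0 i) (j : Fin 7) : ¬ G.Adj v (x j) :=
  fun hj => not_shape_zero i j ((h j).1 (Or.inr hj))

theorem exists_hasShape (hP : HFree G twoP3) (hC4 : HFree G (cycleGraph 4))
    (hC6 : HFree G (cycleGraph 6)) (x : cycleGraph 7 ↪g G) (v : V) :
    ∃ k i, HasShape x v k i := by
  classical
  by_cases hv : ∃ m, v = x m
  · obtain ⟨m, rfl⟩ := hv
    exact ⟨1, m, hasShape_vertex x m⟩
  push Not at hv
  have hadj := adj_cycle_iff x
  have h4 : ∀ i, G.Adj v (x i) → G.Adj v (x (i + 2)) → G.Adj v (x (i + 1)) := by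
    intro i h1 h2
    by_contra h3
    refine hC4.cycle4_elim h1 ((hadj i (i + 1)).2 ?_) ((hadj (i + 1) (i + 2)).2 ?_) h2.symm
      (hv _) (x.injective.ne ?_) h3 ((hadj _ _).not.2 ?_) <;> clear * - <;> decide +revert
  have h6 : ∀ i, G.Adj v (x i) → G.Adj v (x (i + 4)) →
      G.Adj v (x (i + 1)) ∨ G.Adj v (x (i + 2)) ∨ G.Adj v (x (i + 3)) := by
    intro i h1 h2
    by_contra! ⟨h3, h4, h5⟩
    refine hC6.cycle6_elim h1 ((hadj i (i + 1)).2 ?_) ((hadj (i + 1) (i + 2)).2 ?_)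
      ((hadj (i + 2) (i + 3)).2 ?_) ((hadj (i + 3) (i + 4)).2 ?_) h2.symm h3 h4 h5
      ((hadj _ _).not.2 ?_) ((hadj _ _).not.2 ?_) ((hadj _ _).not.2 ?_) ((hadj _ _).not.2 ?_)
      ((hadj _ _).not.2 ?_) ((hadj _ _).not.2 ?_) <;> clear * - <;> decide +revert
  have hiso : ∀ i, G.Adj v (x i) → G.Adj v (x (i + 6)) ∨ G.Adj v (x (i + 2)) ∨
      G.Adj v (x (i + 3)) ∨ G.Adj v (x (i + 4)) := by
    intro i h1
    by_contra! ⟨h2, h3, h4, h5⟩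
    refine hP.twoP3_elim ((hadj (i + 6) i).2 ?_) h1.symm ((hadj (i + 2) (i + 3)).2 ?_)
      ((hadj (i + 3) (i + 4)).2 ?_) (hv _).symm (x.injective.ne ?_) (fun h => h2 h.symm)
      ((hadj _ _).not.2 ?_) ((hadj _ _).not.2 ?_) ((hadj _ _).not.2 ?_) ((hadj _ _).not.2 ?_)
      ((hadj _ _).not.2 ?_) ((hadj _ _).not.2 ?_) ((hadj _ _).not.2 ?_) h3 h4 h5 <;>
      clear * - <;> decide +revert
  obtain ⟨k, i, hki⟩ := exists_eq_shape (fun j => decide (G.Adj v (x j)))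
    (by simpa using h4) (by simpa using h6) (by simpa using hiso)
  refine ⟨k, i, fun j => ?_⟩
  rw [or_iff_right (hv j), ← hki j, decide_eq_true_iff]

theorem eq_of_shape_one : ∀ m m' : Fin 7, (∀ j, shape 1 m j = shape 1 m' j) → m = m' := by
  decide

theorem HasShape.vertex_index {m n : Fin 7} (h : HasShape x (x n) 1 m) : m = n :=
  eq_of_shape_one m n fun j => Bool.eq_iff_iff.2 ((h j).symm.trans (hasShape_vertex x n j))

/-- A vertex of type `X` can replace the corresponding vertex of the cycle. -/
theorem HasShape.exists_replace {m : Fin 7} (h : HasShape x u 1 m) :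
    ∃ y : cycleGraph 7 ↪g G, y m = u ∧ ∀ j, j ≠ m → y j = x j := by
  classical
  have hne : ∀ j, j ≠ m → u ≠ x j := by
    rintro j hj rfl
    exact hj h.vertex_index.symm
  have hu : ∀ j, j ≠ m → (G.Adj u (x j) ↔ cyc m j = true) := by
    intro j hj
    rw [← or_iff_right (hne j hj) (b := G.Adj u (x j)), h j]
    clear * - hj
    decide +revert
  obtain ⟨y, hym, hy⟩ : ∃ y : Fin 7 → V, y m = u ∧ ∀ j, j ≠ m → y j = x j :=
    ⟨Function.update x m u, by simp, fun j hj => Function.update_of_ne hj _ _⟩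
  have hinj : Function.Injective y := by
    intro i j hij
    by_cases hi : i = m <;> by_cases hj : j = m
    · rw [hi, hj]
    · rw [hi, hym, hy j hj] at hij
      exact (hne j hj hij).elim
    · rw [hj, hym, hy i hi] at hij
      exact (hne i hi hij.symm).elim
    · rw [hy i hi, hy j hj] at hij
      exact x.injective hij
  have hadj : ∀ i j, G.Adj (y i) (y j) ↔ (cycleGraph 7).Adj i j := by
    intro i j
    rw [← x.map_adj_iff, adj_cycle_iff]
    by_cases hi : i = m <;> by_cases hj : j = m
    · rw [hi, hj, hym]
      simp only [SimpleGraph.irrefl, false_iff]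
      clear * -
      decide +revert
    · rw [hi, hym, hy j hj, hu j hj]
    · rw [hj, hym, hy i hi, G.adj_comm, hu i hi]
      clear * -
      decide +revert
    · rw [hy i hi, hy j hj, adj_cycle_iff]
  exact ⟨⟨⟨y, hinj⟩, hadj _ _⟩, hym, hy⟩

theorem adj_iff_of_hasShape_one {m : Fin 7}
    (hS : ∀ (y : cycleGraph 7 ↪g G) (w : V), ∃ k i, HasShape y w k i)
    (hu : HasShape x u 1 m) (hv : HasShape x v k i) (huv : u ≠ v) :
    G.Adj v u ↔ shape k i m = true := by
  obtain ⟨y, hym, hy⟩ := hu.exists_replace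
  obtain ⟨k', i', hv'⟩ := hS y v
  have := shape_eq_of_eq_off k' i' k i m fun j hj => by
    rw [Bool.eq_iff_iff, ← hv' j, ← hv j, hy j hj]
  rw [← this, ← hv' m, hym, or_iff_right huv.symm]

theorem adj_of_common (huv : u ≠ v) (nuv : ¬ G.Adj u v) (hu : HasShape x u k i)
    (hv : HasShape x v k' i') {j : Fin 7} (hj : shape k i j) (hj' : shape k' i' j) :
    G.Adj u (x j) ∧ G.Adj v (x j) := by
  rcases (hu j).2 hj with rfl | h1 <;> rcases (hv j).2 hj' with h2 | h2
  · exact (huv h2.symm).elim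
  · exact (nuv h2.symm).elim
  · exact (nuv (h2 ▸ h1)).elim
  · exact ⟨h1, h2⟩

theorem not_sharePair (hC4 : HFree G (cycleGraph 4)) (huv : u ≠ v) (nuv : ¬ G.Adj u v)
    (hu : HasShape x u k i) (hv : HasShape x v k' i') : ¬ SharePair k i k' i' := by
  rintro ⟨c, d, hcd, ncd, huc, hud, hvc, hvd⟩
  obtain ⟨h1, h2⟩ := adj_of_common huv nuv hu hv huc hvc
  obtain ⟨h3, h4⟩ := adj_of_common huv nuv hu hv hud hvd
  exact hC4.cycle4_elim h1 h2.symm h4 h3.symm huv (x.injective.ne hcd) nuv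
    (by rw [adj_cycle_iff, ncd]; decide)

theorem false_of_common_far_neighbor (hC4 : HFree G (cycleGraph 4))
    (hC6 : HFree G (cycleGraph 6)) {i₀ : Fin 7} (ha : HasShape x a 0 i₀)
    (au : G.Adj a u) (av : G.Adj a v) (huv : u ≠ v) (nuv : ¬ G.Adj u v)
    (hk : 1 < k) (hk' : 1 < k') (hu : HasShape x u k i) (hv : HasShape x v k' i') : False := by
  have hadj := adj_cycle_iff x
  have hax := not_adj_of_hasShape_zero ha
  have link : ∀ {u v : V} {k k' : Fin 5} {i i' : Fin 7}, G.Adj a u → G.Adj a v → ¬ G.Adj u v →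
      1 < k → 1 < k' → HasShape x u k i → HasShape x v k' i' → ∀ j, shape k i j →
      ¬ shape k i (j + 1) → ¬ shape k i (j + 2) → ¬ shape k' i' j → ¬ shape k' i' (j + 1) →
      shape k' i' (j + 2) → False := by
    intro u v k k' i i' au av nuv hk hk' hu hv j h1 h2 h3 h4 h5 h6
    rw [← hu.adj_iff hk.ne'] at h1 h2 h3
    rw [← hv.adj_iff hk'.ne'] at h4 h5 h6
    refine hC6.cycle6_elim au h1 ((hadj j (j + 1)).2 ?_) ((hadj (j + 1) (j + 2)).2 ?_) h6.symm
      av.symm (hax _) (hax _) (hax _) h2 h3 nuv ((hadj _ _).not.2 ?_) (fun h => h4 h.symm)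
      (fun h => h5 h.symm) <;> clear * - <;> decide +revert
  rcases shape_meet_or_linked k i k' i' hk hk' with
    ⟨j, h1, h2⟩ | ⟨j, h1, h2, h3, h4, h5, h6⟩ | ⟨j, h1, h2, h3, h4, h5, h6⟩
  · obtain ⟨h1, h2⟩ := adj_of_common huv nuv hu hv h1 h2
    exact hC4.cycle4_elim au h1 h2.symm av.symm (ha.ne_vertex (by decide) j) huv (hax j) nuv
  · exact link au av nuv hk hk' hu hv j h1 h2 h3 h4 h5 h6
  · exact link av au (fun h => nuv h.symm) hk' hk hv hu j h1 h2 h3 h4 h5 h6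

theorem false_of_far_edge (hC4 : HFree G (cycleGraph 4))
    (hC6 : HFree G (cycleGraph 6)) {i₀ i₁ : Fin 7} (ha : HasShape x a 0 i₀)
    (hb : HasShape x b 0 i₁) (ab : G.Adj a b) (au : G.Adj a u) (bv : G.Adj b v)
    (nbu : ¬ G.Adj b u) (nav : ¬ G.Adj a v)
    (hk : 1 < k) (hk' : 1 < k') (hu : HasShape x u k i) (hv : HasShape x v k' i') : False := by
  have hbu : u ≠ b := by
    rintro rfl
    exact (by decide : ∀ k, 1 < k → ∀ i i₁, ∃ j, shape k i j ≠ shape 0 i₁ j) k hk i i₁ |>.elim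
      fun j hj => hj (Bool.eq_iff_iff.2 ((hu j).symm.trans (hb j)))
  have hav : a ≠ v := by
    rintro rfl
    exact (by decide : ∀ k, 1 < k → ∀ i i₁, ∃ j, shape k i j ≠ shape 0 i₁ j) k' hk' i' i₀ |>.elim
      fun j hj => hj (Bool.eq_iff_iff.2 ((hv j).symm.trans (ha j)))
  have huv : u ≠ v := by
    rintro rfl
    exact nav au
  by_cases uv : G.Adj u v
  · exact hC4.cycle4_elim au uv bv.symm ab.symm hav hbu nav fun h => nbu h.symm
  rcases sharePair_or_private_edge k i k' i' hk hk' with h | ⟨c, d, hcd, h1, h2, h3, h4⟩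
  · exact not_sharePair hC4 huv uv hu hv h
  rw [← hu.adj_iff hk.ne'] at h1 h3
  rw [← hv.adj_iff hk'.ne'] at h2 h4
  exact hC6.cycle6_elim au h1 ((adj_cycle_iff x c d).2 hcd) h4.symm bv.symm ab.symm
    (not_adj_of_hasShape_zero ha _) (not_adj_of_hasShape_zero ha _) nav h3 uv
    (fun h => nbu h.symm) (fun h => h2 h.symm)
    (fun h => not_adj_of_hasShape_zero hb _ h.symm)
    (fun h => not_adj_of_hasShape_zero hb _ h.symm)

theorem adj_of_hasShape_two (hP : HFree G twoP3) (hC4 : HFree G (cycleGraph 4))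
    (hC6 : HFree G (cycleGraph 6)) (huv : u ≠ v)
    (hu : HasShape x u 2 i) (hv : HasShape x v 2 i') : G.Adj u v := by
  by_contra nuv
  have hadj := adj_cycle_iff x
  have pat : ∀ {u v : V} {i i' : Fin 7}, ¬ G.Adj u v → HasShape x u 2 i → HasShape x v 2 i' →
      ∀ j, PatternTwoP3 i i' j → False := by
    rintro u v i i' nuv hu hv j ⟨h1, h2, h3, h4, h5, h6, h7, h8⟩
    rw [← hu.adj_iff (by decide)] at h1 h2 h3 h4
    rw [← hv.adj_iff (by decide)] at h5 h6 h7 h8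
    refine hP.twoP3_elim ((hadj (j + 6) j).2 ?_) h1.symm h5 ((hadj (j + 2) (j + 3)).2 ?_)
      (hu.ne_vertex (by decide) _).symm (hv.ne_vertex (by decide) _) (fun h => h2 h.symm) h6
      (fun h => h8 h.symm) ((hadj _ _).not.2 ?_) ((hadj _ _).not.2 ?_) (fun h => h7 h.symm)
      ((hadj _ _).not.2 ?_) ((hadj _ _).not.2 ?_) nuv h3 h4 <;> clear * - <;> decide +revert
  have pat' : ∀ {u v : V} {i i' : Fin 7}, ¬ G.Adj u v → HasShape x u 2 i → HasShape x v 2 i' →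
      ∀ j, PatternC6 i i' j → False := by
    rintro u v i i' nuv hu hv j ⟨h1, h2, h3, h4, h5, h6, h7, h8⟩
    rw [← hu.adj_iff (by decide)] at h1 h2 h3 h4
    rw [← hv.adj_iff (by decide)] at h5 h6 h7 h8
    refine hC6.cycle6_elim h1 ((hadj j (j + 6)).2 ?_) h5.symm h6 ((hadj (j + 2) (j + 3)).2 ?_)
      h2.symm h3 nuv h4 (fun h => h7 h.symm) ((hadj _ _).not.2 ?_) ((hadj _ _).not.2 ?_)
      ((hadj _ _).not.2 ?_) ((hadj _ _).not.2 ?_) h8 <;> clear * - <;> decide +revert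
  rcases shape_two_cases i i' with h | ⟨j, h | h⟩ | ⟨j, h | h⟩
  · exact not_sharePair hC4 huv nuv hu hv h
  · exact pat nuv hu hv j h
  · exact pat (fun h => nuv h.symm) hv hu j h
  · exact pat' nuv hu hv j h
  · exact pat' (fun h => nuv h.symm) hv hu j h

theorem compatible_of_not_adj (hP : HFree G twoP3) (hC4 : HFree G (cycleGraph 4))
    (hC6 : HFree G (cycleGraph 6)) {p q : Fin 5 × Fin 7} (huv : u ≠ v) (nuv : ¬ G.Adj u v)
    (hu : HasShape x u p.1 p.2) (hv : HasShape x v q.1 q.2) : Compatible p q := by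
  have hS := exists_hasShape hP hC4 hC6
  refine ⟨fun h1 h => ?_, fun h1 h => ?_, fun h => ?_, not_sharePair hC4 huv nuv hu hv⟩
  · rw [h1] at hu
    exact nuv ((adj_iff_of_hasShape_one hS hu hv huv).2 h).symm
  · rw [h1] at hv
    exact nuv ((adj_iff_of_hasShape_one hS hv hu huv.symm).2 h)
  · rw [h.1] at hu
    rw [h.2] at hv
    exact nuv (adj_of_hasShape_two hP hC4 hC6 huv hu hv)

theorem hFree_fourK1_of_no_far (hP : HFree G twoP3) (hC4 : HFree G (cycleGraph 4))
    (hC6 : HFree G (cycleGraph 6)) (x : cycleGraph 7 ↪g G)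
    (hfar : ∀ v i, ¬ HasShape x v 0 i) : HFree G fourK1 := by
  intro hc
  obtain ⟨f⟩ := containsInduced_iff.1 hc
  have hS : ∀ n, ∃ p : Fin 5 × Fin 7, p.1 ≠ 0 ∧ HasShape x (f n) p.1 p.2 := by
    intro n
    obtain ⟨k, i, h⟩ := exists_hasShape hP hC4 hC6 x (f n)
    refine ⟨(k, i), ?_, h⟩
    rintro rfl
    exact hfar _ _ h
  choose p hp0 hp using hS
  have hcomp : ∀ m n, m ≠ n → Compatible (p m) (p n) := fun m n hmn =>
    compatible_of_not_adj hP hC4 hC6 (f.injective.ne hmn)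
      (fun h => by simpa [fourK1] using f.map_adj_iff.1 h) (hp m) (hp n)
  exact not_four_compatible (p 0) (p 1) (hp0 0) (hp0 1) (hcomp _ _ (by decide))
    (p 2) (hp0 2) (hcomp _ _ (by decide)) (hcomp _ _ (by decide))
    (p 3) (hp0 3) (hcomp _ _ (by decide)) (hcomp _ _ (by decide)) (hcomp _ _ (by decide))

theorem not_hasShape_zero_of_fourK1 (hK : HFree G fourK1) (x : cycleGraph 7 ↪g G) :
    ¬ HasShape x v 0 i := by
  intro h
  have hne := h.ne_vertex (by decide)
  have hn := not_adj_of_hasShape_zero h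
  refine hK.fourK1_elim (hne 0) (hne 2) (hne 4) (x.injective.ne ?_) (x.injective.ne ?_)
    (x.injective.ne ?_) (hn 0) (hn 2) (hn 4) ((adj_cycle_iff x _ _).not.2 ?_)
    ((adj_cycle_iff x _ _).not.2 ?_) ((adj_cycle_iff x _ _).not.2 ?_) <;> decide

theorem HasShape.not_isSimplicial (hv : HasShape x v k i) (hk : k ≠ 0) : ¬ IsSimplicial G v := by
  intro h
  obtain ⟨c, d, hcd, ncd, hc, hd⟩ := exists_nonadj_of_ne_zero k i hk
  have nadj : ¬ G.Adj (x c) (x d) := by rw [adj_cycle_iff, ncd]; decide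
  rcases (hv c).2 hc with h1 | h1 <;> rcases (hv d).2 hd with h2 | h2
  · exact hcd (x.injective (h1.symm.trans h2))
  · exact nadj (h1 ▸ h2)
  · exact nadj (h2 ▸ h1).symm
  · exact nadj (h h1 h2 (x.injective.ne hcd))

/-- The vertices far from the cycle induce a disjoint union of cliques. -/
theorem far_adj_trans (hP : HFree G twoP3) {c : V} {i₀ i₁ i₂ : Fin 7}
    (ha : HasShape x a 0 i₀) (hb : HasShape x b 0 i₁) (hc : HasShape x c 0 i₂)
    (ab : G.Adj a b) (bc : G.Adj b c) (hac : a ≠ c) : G.Adj a c := by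
  by_contra nac
  refine hP.twoP3_elim ab bc ((adj_cycle_iff x 0 1).2 rfl) ((adj_cycle_iff x 1 2).2 rfl) hac
    (x.injective.ne (by decide)) nac ((adj_cycle_iff x _ _).not.2 (by decide)) ?_ ?_ ?_ ?_ ?_ ?_
    ?_ ?_ ?_ <;>
    apply not_adj_of_hasShape_zero <;> assumption

/-- A vertex far from the cycle of least degree is simplicial. -/
theorem exists_isSimplicial [Fintype V] (hP : HFree G twoP3) (hC4 : HFree G (cycleGraph 4))
    (hC6 : HFree G (cycleGraph 6)) (h : HasShape x v 0 i) : ∃ a, IsSimplicial G a := by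
  classical
  obtain ⟨a, ⟨i₀, ha⟩, hmin⟩ := Set.exists_min_image {a | ∃ i, HasShape x a 0 i} (fun a => G.degree a)
    (Set.toFinite _) ⟨v, i, h⟩
  have hS := exists_hasShape hP hC4 hC6
  have far_nbr : ∀ {a u i₀}, HasShape x a 0 i₀ → G.Adj a u →
      (∃ i, HasShape x u 0 i) ∨ ∃ k i, 1 < k ∧ HasShape x u k i := by
    intro a u i₀ ha au
    obtain ⟨k, i, hu⟩ := hS x u
    rcases (by decide : ∀ k : Fin 5, k = 0 ∨ k = 1 ∨ 1 < k) k with rfl | rfl | hk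
    · exact Or.inl ⟨i, hu⟩
    · exact (not_shape_zero _ _ ((adj_iff_of_hasShape_one hS hu ha au.ne').1 au)).elim
    · exact Or.inr ⟨k, i, hk, hu⟩
  have mixed : ∀ {b c i₁ k i}, HasShape x b 0 i₁ → 1 < k → HasShape x c k i → G.Adj a b →
      G.Adj a c → b ≠ c → G.Adj b c := by
    intro b c i₁ k i hb hk hc ab ac hbc
    by_contra nbc
    obtain ⟨d, bd, hda, nad⟩ : ∃ d, G.Adj b d ∧ d ≠ a ∧ ¬ G.Adj a d := by
      by_contra! hd
      have hsub : insert c ((G.neighborFinset b).erase a) ⊆ (G.neighborFinset a).erase b := by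
        intro d hd'
        simp only [Finset.mem_insert, Finset.mem_erase, mem_neighborFinset] at hd' ⊢
        rcases hd' with rfl | ⟨h1, h2⟩
        · exact ⟨hbc.symm, ac⟩
        · exact ⟨h2.ne', hd d h2 h1⟩
      have hcard := Finset.card_le_card hsub
      rw [Finset.card_insert_of_notMem (by simp [nbc]),
        Finset.card_erase_of_mem (by simpa using ab.symm),
        Finset.card_erase_of_mem (by simpa using ab), card_neighborFinset_eq_degree,
        card_neighborFinset_eq_degree] at hcard
      have := hmin b ⟨i₁, hb⟩
      omega
    rcases far_nbr hb bd with ⟨j, hd⟩ | ⟨k', j, hk', hd⟩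
    · exact nad (far_adj_trans hP ha hb hd ab bd hda.symm)
    · exact false_of_far_edge hC4 hC6 ha hb ab ac bd nbc nad hk hk' hc hd
  refine ⟨a, fun b ab c ac hbc => ?_⟩
  rw [mem_neighborSet] at ab ac
  rcases far_nbr ha ab with ⟨j, hb⟩ | ⟨k, j, hk, hb⟩ <;>
    rcases far_nbr ha ac with ⟨j', hc⟩ | ⟨k', j', hk', hc⟩
  · exact far_adj_trans hP hb ha hc ab.symm ac hbc
  · exact mixed hb hk' hc ab ac hbc
  · exact (mixed hc hk hb ac ab hbc.symm).symm
  · by_contra nbc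
    exact false_of_common_far_neighbor hC4 hC6 ha ab ac hbc nbc hk hk' hb hc

end Trace

/-- A graph is `(2P_3,C_4,C_6)`-free, contains an induced `C_7`, and contains no
simplicial vertices if and only if it is `(4K_1,C_4,C_6)`-free and contains an
induced `C_7`. -/
theorem statement1 {V : Type*} [Fintype V] (G : SimpleGraph V) :
    (HFree G twoP3 ∧ HFree G (cycleGraph 4) ∧ HFree G (cycleGraph 6) ∧
      ContainsInduced G (cycleGraph 7) ∧ (∀ v : V, ¬ IsSimplicial G v)) ↔
    (HFree G fourK1 ∧ HFree G (cycleGraph 4) ∧ HFree G (cycleGraph 6) ∧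
      ContainsInduced G (cycleGraph 7)) := by
  constructor
  · rintro ⟨hP, hC4, hC6, hC7, hsimp⟩
    obtain ⟨x⟩ := containsInduced_iff.1 hC7
    refine ⟨hFree_fourK1_of_no_far hP hC4 hC6 x fun v i h => ?_, hC4, hC6, hC7⟩
    obtain ⟨a, ha⟩ := exists_isSimplicial hP hC4 hC6 h
    exact hsimp a ha
  · rintro ⟨hK, hC4, hC6, hC7⟩
    obtain ⟨x⟩ := containsInduced_iff.1 hC7
    have hP := hK.twoP3_of_fourK1
    refine ⟨hP, hC4, hC6, hC7, fun v => ?_⟩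
    obtain ⟨k, i, hv⟩ := exists_hasShape hP hC4 hC6 x v
    refine hv.not_isSimplicial ?_
    rintro rfl
    exact not_hasShape_zero_of_fourK1 hK x hv

end Paper2P3
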